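/- Let d, k ≥ 1, let S ∈ M_d(ℂ) be a fixed invertible matrix defining the bilinear form (u,v) = uᵀ·S·v on (ℂ((z)))^d, let h : Fin (k+1) → ℤ, and let e_1, …, e_{k+1} ∈ (ℂ((z)))^d be vectors such that every entry of e_s has z-order at least h s (i.e. coefficient of z^p vanishes for p < h s). Let G be the k×k Gram matrix G i j = (e_i, e_j) for i,j ≤ k, and assume det G ≠ 0 with (det G).coeff q ≠ 0 for q = 2·Σ_{i ≤ k} h i (the determinant has exact order 2·Σ_{i≤k} h i). Then the unique λ_1, …, λ_k ∈ ℂ((z)) satisfying (e_{k+1} + Σ_{s=1}^{k} λ_s·e_s, e_j) = 0 for all j ≤ k exist, each λ_s has z-order at least h(k+1) - h s, and consequently every entry of the orthogonalized vector e_{k+1} + Σ_{s=1}^{k} λ_s·e_s has z-order at least h(k+1). -/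

import Mathlib

open Matrix

/-- The bilinear form `(u,v) = Σ_{a,b} u_a·S_{ab}·v_b` on `(ℂ((z)))^d` associated to a complex
matrix `S` (scalars embedded as constant Laurent series). -/
noncomputable def laurentForm {d : ℕ} (S : Matrix (Fin d) (Fin d) ℂ)
    (u v : Fin d → LaurentSeries ℂ) : LaurentSeries ℂ :=
  ∑ a : Fin d, ∑ b : Fin d, u a * (HahnSeries.C (S a b) : LaurentSeries ℂ) * v b

theorem AddValuation.sum_le_map_prod {R Γ ι : Type*} [CommRing R]
    [LinearOrderedAddCommMonoidWithTop Γ] (v : AddValuation R Γ) (s : Finset ι)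
    {f : ι → R} {g : ι → Γ} (hf : ∀ i ∈ s, g i ≤ v (f i)) :
    ∑ i ∈ s, g i ≤ v (∏ i ∈ s, f i) := by
  classical
  induction s using Finset.induction_on with
  | empty => simp
  | insert a s ha ih =>
    rw [Finset.sum_insert ha, Finset.prod_insert ha, v.map_mul]
    exact add_le_add (hf a (Finset.mem_insert_self a s))
      (ih fun i hi => hf i (Finset.mem_insert_of_mem hi))

theorem AddValuation.sum_add_sum_le_map_det {R Γ n : Type*} [CommRing R] [Fintype n]
    [DecidableEq n] [LinearOrderedAddCommMonoidWithTop Γ] (v : AddValuation R Γ)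
    {M : Matrix n n R} {r c : n → Γ} (hM : ∀ i j, r i + c j ≤ v (M i j)) :
    ∑ i, r i + ∑ j, c j ≤ v M.det := by
  rw [det_apply]
  refine v.map_le_sum fun σ _ => ?_
  have hprod : ∑ i, r i + ∑ j, c j ≤ v (∏ i, M (σ i) i) := by
    rw [← Equiv.sum_comp σ r, ← Finset.sum_add_distrib]
    exact v.sum_le_map_prod _ fun i _ => hM _ _
  rcases Int.units_eq_one_or (Equiv.Perm.sign σ) with hσ | hσ
  · rwa [hσ, one_smul]
  · rwa [hσ, Units.neg_smul, one_smul, v.map_neg]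

theorem HahnSeries.coe_le_addVal_iff {Γ R : Type*} [AddCommGroup Γ] [LinearOrder Γ]
    [IsOrderedAddMonoid Γ] [Ring R] [IsDomain R] {x : HahnSeries Γ R} {g : Γ} :
    (g : WithTop Γ) ≤ addVal Γ R x ↔ ∀ p < g, x.coeff p = 0 := by
  simp [addVal_apply, le_orderTop_iff_forall]

theorem laurentForm_add_sum_smul_left {d : ℕ} {ι : Type*} [Fintype ι]
    (S : Matrix (Fin d) (Fin d) ℂ) (u w : Fin d → LaurentSeries ℂ) (c : ι → LaurentSeries ℂ)
    (f : ι → Fin d → LaurentSeries ℂ) :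
    laurentForm S (u + ∑ s, c s • f s) w =
      laurentForm S u w + ∑ s, c s * laurentForm S (f s) w := by
  simp only [laurentForm, Pi.add_apply, Finset.sum_apply, Pi.smul_apply, smul_eq_mul, add_mul,
    Finset.sum_mul, Finset.mul_sum, Finset.sum_add_distrib]
  congr 1
  rw [Finset.sum_comm_cycle]
  simp only [mul_assoc]

theorem add_le_addVal_laurentForm {d : ℕ} (S : Matrix (Fin d) (Fin d) ℂ)
    {u w : Fin d → LaurentSeries ℂ} {m n : WithTop ℤ}
    (hu : ∀ a, m ≤ HahnSeries.addVal ℤ ℂ (u a)) (hw : ∀ a, n ≤ HahnSeries.addVal ℤ ℂ (w a)) :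
    m + n ≤ HahnSeries.addVal ℤ ℂ (laurentForm S u w) := by
  refine AddValuation.map_le_sum _ fun a _ => AddValuation.map_le_sum _ fun b _ => ?_
  rw [AddValuation.map_mul, AddValuation.map_mul]
  have hC : (0 : WithTop ℤ) ≤ HahnSeries.addVal ℤ ℂ (HahnSeries.C (S a b)) := by
    rw [HahnSeries.addVal_apply]
    exact HahnSeries.orderTop_single_le
  exact add_le_add (le_add_of_le_of_nonneg (hu a) hC) (hw b)

/-- Gram–Schmidt (skew-)orthogonalization preserves `z`-orders: if the vectors `e_1,…,e_{k+1}`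
have entrywise `z`-orders at least `h 1,…,h (k+1)` and the Gram determinant of the first `k`
vectors has exact order `2·Σ_{i≤k} h i`, then the unique `λ_1,…,λ_k` making
`e_{k+1} + Σ_s λ_s·e_s` orthogonal to `e_1,…,e_k` exist, each `λ_s` has order at least
`h (k+1) - h s`, and the orthogonalized vector has entrywise order at least `h (k+1)`. -/
theorem gram_schmidt_preserves_orders {d k : ℕ} (hd : 1 ≤ d) (hk : 1 ≤ k)
    (S : Matrix (Fin d) (Fin d) ℂ) (hS : IsUnit S)
    (h : Fin (k + 1) → ℤ) (e : Fin (k + 1) → (Fin d → LaurentSeries ℂ))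
    (horder : ∀ (s : Fin (k + 1)) (a : Fin d) (p : ℤ), p < h s → (e s a).coeff p = 0)
    (G : Matrix (Fin k) (Fin k) (LaurentSeries ℂ))
    (hG : G = Matrix.of fun i j : Fin k => laurentForm S (e i.castSucc) (e j.castSucc))
    (hdet : G.det ≠ 0)
    (hexact : (G.det).coeff (2 * ∑ i : Fin k, h i.castSucc) ≠ 0) :
    ∃ lam : Fin k → LaurentSeries ℂ,
      (∀ j : Fin k,
        laurentForm S (e (Fin.last k) + ∑ s : Fin k, lam s • e s.castSucc) (e j.castSucc) = 0) ∧
      (∀ lam' : Fin k → LaurentSeries ℂ,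
        (∀ j : Fin k,
          laurentForm S (e (Fin.last k) + ∑ s : Fin k, lam' s • e s.castSucc) (e j.castSucc) = 0)
        → lam' = lam) ∧
      (∀ (s : Fin k) (p : ℤ), p < h (Fin.last k) - h s.castSucc → (lam s).coeff p = 0) ∧
      (∀ (a : Fin d) (p : ℤ), p < h (Fin.last k) →
        ((e (Fin.last k) + ∑ s : Fin k, lam s • e s.castSucc) a).coeff p = 0) := by
  set v := HahnSeries.addVal ℤ ℂ
  have he : ∀ s a, ((h s : ℤ) : WithTop ℤ) ≤ v (e s a) := fun s a =>
    HahnSeries.coe_le_addVal_iff.2 (horder s a)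
  set b : Fin k → LaurentSeries ℂ := fun j =>
    -laurentForm S (e (Fin.last k)) (e j.castSucc) with hb
  have hsystem : ∀ lam : Fin k → LaurentSeries ℂ,
      (∀ j : Fin k,
        laurentForm S (e (Fin.last k) + ∑ s : Fin k, lam s • e s.castSucc) (e j.castSucc) = 0) ↔
      Gᵀ *ᵥ lam = b := by
    intro lam
    rw [funext_iff]
    refine forall_congr' fun j => ?_
    rw [laurentForm_add_sum_smul_left, add_eq_zero_iff_neg_eq, eq_comm]
    simp [hb, hG, mulVec, dotProduct, mul_comm]
  have hunit : IsUnit Gᵀ := by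
    rw [isUnit_iff_isUnit_det, det_transpose]
    exact hdet.isUnit
  obtain ⟨lam, hlam⟩ := mulVec_surjective_iff_isUnit.2 hunit b
  have hlam_order : ∀ s : Fin k,
      ((h (Fin.last k) - h s.castSucc : ℤ) : WithTop ℤ) ≤ v (lam s) := by
    intro s
    have hcramer : (G.updateRow s b).det = G.det * lam s := by
      rw [← cramer_transpose_apply, cramer_eq_adjugate_mulVec, ← hlam, mulVec_mulVec,
        adjugate_mul, det_transpose, smul_mulVec, one_mulVec, Pi.smul_apply, smul_eq_mul]
    set r : Fin k → ℤ := Function.update (fun i => h i.castSucc) s (h (Fin.last k)) with hr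
    have hentries : ∀ i j,
        ((r i : ℤ) : WithTop ℤ) + ((h j.castSucc : ℤ) : WithTop ℤ) ≤
          v (G.updateRow s b i j) := by
      intro i j
      rcases eq_or_ne i s with rfl | hi
      · rw [updateRow_self, hr, Function.update_self, hb, AddValuation.map_neg]
        exact add_le_addVal_laurentForm S (he _) (he _)
      · rw [updateRow_ne hi, hr, Function.update_of_ne hi, hG, of_apply]
        exact add_le_addVal_laurentForm S (he _) (he _)
    have hle := v.sum_add_sum_le_map_det hentries
    rw [hcramer, v.map_mul] at hle
    have hdet_le : v G.det ≤ ((2 * ∑ i : Fin k, h i.castSucc : ℤ) : WithTop ℤ) :=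
      HahnSeries.addVal_le_of_coeff_ne_zero hexact
    have hsum : ∑ i, r i = h (Fin.last k) + (∑ i : Fin k, h i.castSucc - h s.castSucc) := by
      rw [hr, Finset.sum_update_of_mem (Finset.mem_univ s),
        ← Finset.add_sum_erase _ _ (Finset.mem_univ s), Finset.sdiff_singleton_eq_erase,
        add_sub_cancel_left]
    replace hle := hle.trans (add_le_add_left hdet_le _)
    rw [← WithTop.coe_sum, ← WithTop.coe_sum, ← WithTop.coe_add, hsum] at hle
    cases hv : v (lam s) with
    | top => exact le_top
    | coe m =>
      rw [hv, ← WithTop.coe_add, WithTop.coe_le_coe] at hle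
      rw [WithTop.coe_le_coe]
      linarith
  refine ⟨lam, (hsystem lam).2 hlam, fun lam' hlam' => ?_,
    fun s => HahnSeries.coe_le_addVal_iff.1 (hlam_order s),
    fun a => HahnSeries.coe_le_addVal_iff.1 ?_⟩
  · exact mulVec_injective_iff_isUnit.2 hunit (((hsystem lam').1 hlam').trans hlam.symm)
  · rw [Pi.add_apply, Finset.sum_apply]
    refine v.map_le_add (he _ a) (v.map_le_sum fun s _ => ?_)
    rw [Pi.smul_apply, smul_eq_mul, v.map_mul]
    refine le_trans (le_of_eq ?_) (add_le_add (hlam_order s) (he _ a))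
    rw [← WithTop.coe_add, sub_add_cancel]
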